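/- Let H be a complex polynomial in two variables of degree at most m+1, let c ∈ ℂ, and define the polynomial H^{uz}(u,z) := u^{m+1}·(H(1/u, z/u) − c). Let f := ∂H/∂y, g := −∂H/∂x, and f₁(u,z) := uᵐ·f(1/u, z/u), g₁(u,z) := uᵐ·g(1/u, z/u). Then the polynomial identities ∂H^{uz}/∂z (u,z) = f₁(u,z) and u·∂H^{uz}/∂u (u,z) = g₁(u,z) − z·f₁(u,z) + (m+1)·H^{uz}(u,z) hold identically. In particular, on the zero level set {H^{uz} = 0} and for u ≠ 0, the blow-up system du/dt₁ = −u·f₁(u,z), dz/dt₁ = g₁(u,z) − z·f₁(u,z) takes the Hamiltonian form du/dt₁ = −u·∂H^{uz}/∂z, dz/dt₁ = u·∂H^{uz}/∂u, i.e. it is Hamiltonian for the Hamiltonian function H^{uz} with respect to the symplectic form Ω^{uz} = −u⁻¹ du ∧ dz. -/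

import Mathlib

/-- Evaluation of a polynomial in two variables at `(x, y)`. -/
noncomputable def evP (p : MvPolynomial (Fin 2) ℂ) (x y : ℂ) : ℂ :=
  MvPolynomial.eval ![x, y] p

/-- Chain rule for a two-variable polynomial along a differentiable curve. -/
theorem evP_chain (p : MvPolynomial (Fin 2) ℂ) (a b : ℂ → ℂ) (da db t : ℂ)
    (ha : HasDerivAt a da t) (hb : HasDerivAt b db t) :
    HasDerivAt (fun s => evP p (a s) (b s))
      (evP (MvPolynomial.pderiv 0 p) (a t) (b t) * da +
        evP (MvPolynomial.pderiv 1 p) (a t) (b t) * db) t := by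
  induction p using MvPolynomial.induction_on with
  | C r => simpa [evP] using hasDerivAt_const t r
  | add p q hp hq =>
    refine (hp.add hq).congr_deriv ?_ |>.congr_of_eventuallyEq ?_
    · simp only [evP, map_add]; ring
    · exact Filter.Eventually.of_forall fun s => by simp [evP]
  | mul_X p i hp =>
    fin_cases i
    · refine (hp.mul ha).congr_deriv ?_ |>.congr_of_eventuallyEq ?_
      · simp [evP, MvPolynomial.pderiv_X]; ring
      · exact Filter.Eventually.of_forall fun s => by simp [evP]
    · refine (hp.mul hb).congr_deriv ?_ |>.congr_of_eventuallyEq ?_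
      · simp [evP, MvPolynomial.pderiv_X]; ring
      · exact Filter.Eventually.of_forall fun s => by simp [evP]

/-- Hamiltonian structure of the blow-up chart.  With
`H^{uz}(u,z) = u^{m+1}(H(1/u, z/u) − c)`, `f = H_y`, `g = −H_x`,
`f₁ = uᵐ f(1/u, z/u)`, `g₁ = uᵐ g(1/u, z/u)`, one has
`∂H^{uz}/∂z = f₁` and `u·∂H^{uz}/∂u = g₁ − z f₁ + (m+1) H^{uz}`;
on `{H^{uz} = 0}` the blow-up system is Hamiltonian for `H^{uz}` with respect to
`Ω^{uz} = −u⁻¹ du ∧ dz`. -/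
theorem hamiltonian_blowup_chart
    (m : ℕ) (H : MvPolynomial (Fin 2) ℂ) (hdeg : H.totalDegree ≤ m + 1) (c : ℂ) :
    ∀ u z : ℂ, u ≠ 0 →
      HasDerivAt (fun z' : ℂ => u ^ (m + 1) * (evP H u⁻¹ (z' / u) - c))
        (u ^ m * evP (MvPolynomial.pderiv 1 H) u⁻¹ (z / u)) z ∧
      ∃ D : ℂ,
        HasDerivAt (fun u' : ℂ => u' ^ (m + 1) * (evP H u'⁻¹ (z / u') - c)) D u ∧
        u * D =
          (u ^ m * (-(evP (MvPolynomial.pderiv 0 H) u⁻¹ (z / u))))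
            - z * (u ^ m * evP (MvPolynomial.pderiv 1 H) u⁻¹ (z / u))
            + ((m : ℂ) + 1) * (u ^ (m + 1) * (evP H u⁻¹ (z / u) - c)) ∧
        (u ^ (m + 1) * (evP H u⁻¹ (z / u) - c) = 0 →
          u * D =
            (u ^ m * (-(evP (MvPolynomial.pderiv 0 H) u⁻¹ (z / u))))
              - z * (u ^ m * evP (MvPolynomial.pderiv 1 H) u⁻¹ (z / u))) := by
  intro u z hu
  refine ⟨?_, ?_⟩
  · have h := ((evP_chain H (fun _ => u⁻¹) (fun s => s / u) 0 (1 / u) z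
      (hasDerivAt_const z _) ((hasDerivAt_id z).div_const u)).sub_const c).const_mul (u ^ (m + 1))
    refine h.congr_deriv ?_
    field_simp
    ring
  · have hb : HasDerivAt (fun s : ℂ => z / s) (z * (-(u ^ 2)⁻¹)) u := by
      simpa only [div_eq_mul_inv] using (hasDerivAt_inv hu).const_mul z
    have h := (hasDerivAt_pow (m + 1) u).mul
      ((evP_chain H (fun s => s⁻¹) (fun s => z / s) _ _ u (hasDerivAt_inv hu) hb).sub_const c)
    have key : ∀ A B E : ℂ, u * (((m + 1 : ℕ) : ℂ) * u ^ (m + 1 - 1) * (E - c) +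
        u ^ (m + 1) * (A * (-(u ^ 2)⁻¹) + B * (z * (-(u ^ 2)⁻¹)))) =
        u ^ m * (-A) - z * (u ^ m * B) + ((m : ℂ) + 1) * (u ^ (m + 1) * (E - c)) := by
      intro A B E
      rw [Nat.add_sub_cancel, Nat.cast_add, Nat.cast_one]
      field_simp
      ring
    refine ⟨_, h, key _ _ _, fun h0 => ?_⟩
    refine (key _ _ _).trans ?_
    rw [h0]
    ring
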